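/- det D_p(k) = (−1)^{n−1} · n^{n−2} · a_p(k), where D_p(k) = [a_{ij}]_{1≤i,j≤n−1} is the matrix with a_{ii} = −p on the diagonal and a_{ij} = G_p(χ^{ki−kj}) off the diagonal, and a_p(k) is the coefficient of t in the minimal polynomial over ℚ of θ_k = Σ_{y∈U_k} (ζ_p^y − 1). -/

import Mathlib

/-- The sum of `ζ ^ x - 1` over the `x` in `𝔽_p` with `x ^ k = t`. -/
def shiftedPeriod {p : ℕ} [Fact p.Prime] {R : Type*} [CommRing R] (ζ : R) (k : ℕ)
    (t : ZMod p) : R :=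
  ∑ x ∈ Finset.univ.filter (fun x : ZMod p => x ^ k = t), (ζ ^ x.val - 1)

section ShiftedPeriod

variable {p : ℕ} [Fact p.Prime]

theorem map_shiftedPeriod {R S F : Type*} [CommRing R] [CommRing S] [FunLike F R S]
    [RingHomClass F R S] (φ : F) (ζ : R) (k : ℕ) (t : ZMod p) :
    φ (shiftedPeriod ζ k t) = shiftedPeriod (φ ζ) k t := by
  simp [shiftedPeriod]

theorem shiftedPeriod_pow_val {R : Type*} [CommRing R] {ζ : R} (hζ : ζ ^ p = 1) (k : ℕ)
    {u : ZMod p} (hu : u ≠ 0) (t : ZMod p) :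
    shiftedPeriod (ζ ^ u.val) k t = shiftedPeriod ζ k (u ^ k * t) := by
  unfold shiftedPeriod
  refine Finset.sum_bij' (fun x _ => u * x) (fun x _ => u⁻¹ * x) ?_ ?_ ?_ ?_ ?_
  · intro x hx
    simp only [Finset.mem_filter, Finset.mem_univ, true_and] at hx ⊢
    rw [mul_pow, hx]
  · intro x hx
    simp only [Finset.mem_filter, Finset.mem_univ, true_and] at hx ⊢
    rw [mul_pow, hx, ← mul_assoc, ← mul_pow, inv_mul_cancel₀ hu, one_pow, one_mul]
  · intro x _
    field_simp
  · intro x _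
    field_simp
  · intro x _
    rw [ZMod.val_mul, ← pow_mul, ← pow_eq_pow_mod _ hζ]

/-- The numbers `ζ, ζ², …, ζ^{p-1}` are linearly independent over `ℚ`. -/
theorem eq_zero_of_sum_mul_pow_val_eq_zero {ζ : ℂ} (hζ : IsPrimitiveRoot ζ p)
    {f : ZMod p → ℚ} (hf0 : f 0 = 0) (hf : ∑ x, (f x : ℂ) * ζ ^ x.val = 0) (x : ZMod p) :
    f x = 0 := by
  have hp : p.Prime := Fact.out
  have hdeg : (minpoly ℚ ζ).natDegree = p - 1 := by
    rw [← Polynomial.cyclotomic_eq_minpoly_rat hζ hp.pos, Polynomial.natDegree_cyclotomic,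
      Nat.totient_prime hp]
  have hli := Fintype.linearIndependent_iff.1 (linearIndependent_pow (K := ℚ) ζ)
  have hsum : ∑ i ∈ Finset.range p, (f (i : ZMod p) : ℂ) * ζ ^ i = 0 := by
    rw [← hf]
    refine Finset.sum_bij' (fun i _ => (i : ZMod p)) (fun x _ => x.val) ?_ ?_ ?_ ?_ ?_
    · simp
    · intro x _
      simpa using ZMod.val_lt x
    · intro i hi
      exact ZMod.val_cast_of_lt (Finset.mem_range.1 hi)
    · intro x _
      simp
    · intro i hi
      rw [ZMod.val_cast_of_lt (Finset.mem_range.1 hi)]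
  have key : ∀ i, i < p - 1 → f ((i + 1 : ℕ) : ZMod p) = 0 := by
    intro i hi
    refine hli (fun j => f ((j + 1 : ℕ) : ZMod p)) ?_ ⟨i, by rw [hdeg]; exact hi⟩
    obtain ⟨q, rfl⟩ : ∃ q, p = q + 1 := ⟨p - 1, by have := hp.pos; omega⟩
    rw [Finset.sum_range_succ'] at hsum
    simp only [Nat.cast_zero, hf0, Rat.cast_zero, zero_mul, add_zero, pow_succ, ← mul_assoc,
      ← Finset.sum_mul] at hsum
    have h0 := (mul_eq_zero.1 hsum).resolve_right (hζ.ne_zero hp.ne_zero)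
    rw [Finset.sum_range] at h0
    rw [← h0]
    simp only [Nat.add_sub_cancel] at hdeg
    refine Fintype.sum_equiv (finCongr hdeg) _ _ ?_
    intro j
    simp [Algebra.smul_def]
  rcases eq_or_ne x 0 with rfl | hx
  · exact hf0
  · have h1 : x.val ≠ 0 := by simpa using hx
    have h2 := ZMod.val_lt x
    have := key (x.val - 1) (by omega)
    rwa [Nat.sub_add_cancel (by omega), ZMod.natCast_zmod_val] at this

theorem shiftedPeriod_pow_injective {ζ : ℂ} (hζ : IsPrimitiveRoot ζ p) {k : ℕ}
    (hk : k ≠ 0) {u v : ZMod p} (hu : u ≠ 0) (hv : v ≠ 0)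
    (h : shiftedPeriod ζ k (u ^ k) = shiftedPeriod ζ k (v ^ k)) : u ^ k = v ^ k := by
  classical
  by_contra hne
  have hcard : (Finset.univ.filter fun x : ZMod p => x ^ k = u ^ k).card =
      (Finset.univ.filter fun x : ZMod p => x ^ k = v ^ k).card := by
    refine Finset.card_bij' (fun x _ => v * u⁻¹ * x) (fun x _ => u * v⁻¹ * x) ?_ ?_ ?_ ?_
    · intro x hx
      simp only [Finset.mem_filter, Finset.mem_univ, true_and] at hx ⊢
      rw [mul_pow, hx, ← mul_pow, inv_mul_cancel_right₀ hu]
    · intro x hx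
      simp only [Finset.mem_filter, Finset.mem_univ, true_and] at hx ⊢
      rw [mul_pow, hx, ← mul_pow, inv_mul_cancel_right₀ hv]
    · intro x _
      field_simp
    · intro x _
      field_simp
  unfold shiftedPeriod at h
  rw [Finset.sum_sub_distrib, Finset.sum_sub_distrib, Finset.sum_const, Finset.sum_const, hcard,
    sub_left_inj] at h
  let f : ZMod p → ℚ := fun x => (if x ^ k = u ^ k then 1 else 0) - (if x ^ k = v ^ k then 1 else 0)
  have hf : f u = 0 := by
    refine eq_zero_of_sum_mul_pow_val_eq_zero hζ ?_ ?_ u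
    · simp [f, zero_pow hk, (pow_ne_zero k hu).symm, (pow_ne_zero k hv).symm]
    · have hmul : ∀ (x : ZMod p) (w : ℂ), (f x : ℂ) * w =
          (if x ^ k = u ^ k then w else 0) - (if x ^ k = v ^ k then w else 0) := by
        intro x w
        simp only [f]
        split_ifs <;> simp
      simp only [hmul, Finset.sum_sub_distrib]
      rw [← Finset.sum_filter, ← Finset.sum_filter, h, sub_self]
  simp [f, hne] at hf

/-- The fibres of `x ↦ x ^ k` over the powers of `γ` partition the nonzero elements of `𝔽_p`. -/
theorem sum_eq_sum_pow_fiber {M : Type*} [AddCommMonoid M] {n k : ℕ} (hnk : p - 1 = k * n)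
    (hn : n ≠ 0)
    {γ : ZMod p} (hγ : IsPrimitiveRoot γ n) {f : ZMod p → M} (hf : f 0 = 0) :
    ∑ x, f x =
      ∑ c : Fin n, ∑ x ∈ Finset.univ.filter (fun x : ZMod p => x ^ k = γ ^ (c : ℕ)), f x := by
  classical
  have : NeZero n := ⟨hn⟩
  simp only [Finset.sum_filter]
  rw [Finset.sum_comm]
  refine Finset.sum_congr rfl fun x _ => ?_
  rcases eq_or_ne x 0 with rfl | hx
  · simp [hf]
  · obtain ⟨c, hc, hcx⟩ := hγ.eq_pow_of_pow_eq_one (ξ := x ^ k)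
      (by rw [← pow_mul, ← hnk, ZMod.pow_card_sub_one_eq_one hx])
    rw [Finset.sum_eq_single ⟨c, hc⟩]
    · simp [hcx]
    · intro b _ hb
      rw [if_neg]
      intro h
      exact hb (Fin.ext (hγ.pow_inj b.2 hc (by rw [← h, hcx])))
    · simp

theorem rootSet_minpoly_shiftedPeriod {ζ : ℂ} (hζ : IsPrimitiveRoot ζ p) (k : ℕ) :
    (minpoly ℚ (shiftedPeriod ζ k (1 : ZMod p))).rootSet ℂ =
      {r | ∃ u : ZMod p, u ≠ 0 ∧ shiftedPeriod ζ k (u ^ k) = r} := by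
  have hp : p.Prime := Fact.out
  have hint : IsIntegral ℚ ζ := (hζ.isIntegral hp.pos).tower_top
  let K := IntermediateField.adjoin ℚ {ζ}
  have : FiniteDimensional ℚ K := IntermediateField.adjoin.finiteDimensional hint
  let z : K := IntermediateField.AdjoinSimple.gen ℚ ζ
  have hz : algebraMap K ℂ z = ζ := IntermediateField.AdjoinSimple.algebraMap_gen ℚ ζ
  have hzp : IsPrimitiveRoot z p := by
    rw [← hz] at hζ
    exact hζ.of_map_of_injective (algebraMap K ℂ).injective
  have hpow : ζ ^ p = 1 := hζ.pow_eq_one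
  rw [← hz, ← map_shiftedPeriod, minpoly.algebraMap_eq (algebraMap K ℂ).injective,
    ← Algebra.IsAlgebraic.range_eval_eq_rootSet_minpoly, hz]
  ext r
  simp only [Set.mem_range, Set.mem_ofPred_eq, map_shiftedPeriod]
  constructor
  · rintro ⟨ψ, rfl⟩
    obtain ⟨m, hm, hcop, hmz⟩ := (hζ.isPrimitiveRoot_iff (ξ := ψ z)).1
      (hzp.map_of_injective ψ.injective)
    have hv : (m : ZMod p).val = m := ZMod.val_cast_of_lt hm
    have hu : (m : ZMod p) ≠ 0 := by
      intro h
      rw [h, ZMod.val_zero] at hv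
      rw [← hv, Nat.coprime_zero_left] at hcop
      exact hp.one_lt.ne' hcop
    refine ⟨m, hu, ?_⟩
    rw [← hmz, ← mul_one ((m : ZMod p) ^ k), ← shiftedPeriod_pow_val hpow k hu, hv]
  · rintro ⟨u, hu, rfl⟩
    have hmem : ζ ^ u.val ∈ (minpoly ℚ z).rootSet ℂ := by
      rw [← Polynomial.cyclotomic_eq_minpoly_rat hzp hp.pos,
        Polynomial.mem_rootSet_of_ne (Polynomial.cyclotomic_ne_zero p ℚ), Polynomial.aeval_def,
        Polynomial.eval₂_eq_eval_map, Polynomial.map_cyclotomic]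
      refine (hζ.pow_of_coprime _ ?_).isRoot_cyclotomic hp.pos
      exact ZMod.val_coe_unit_coprime (Units.mk0 u hu)
    rw [← Algebra.IsAlgebraic.range_eval_eq_rootSet_minpoly] at hmem
    obtain ⟨ψ, hψ⟩ := hmem
    refine ⟨ψ, ?_⟩
    simp only at hψ
    rw [hψ, shiftedPeriod_pow_val hpow k hu, mul_one]

theorem minpoly_shiftedPeriod_map {ζ : ℂ} (hζ : IsPrimitiveRoot ζ p) {n k : ℕ}
    (hnk : p - 1 = k * n) (hn : n ≠ 0) (hk : k ≠ 0) {g : ZMod p} (hg : g ≠ 0)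
    (hγ : IsPrimitiveRoot (g ^ k) n) :
    (minpoly ℚ (shiftedPeriod ζ k (1 : ZMod p))).map (algebraMap ℚ ℂ) =
      ∏ c : Fin n, (Polynomial.X - Polynomial.C (shiftedPeriod ζ k ((g ^ k) ^ (c : ℕ)))) := by
  classical
  have hp : p.Prime := Fact.out
  have : NeZero n := ⟨hn⟩
  have hint : IsIntegral ℚ (shiftedPeriod ζ k (1 : ZMod p)) :=
    IsIntegral.sum _ fun x _ =>
      (((hζ.isIntegral hp.pos).tower_top (A := ℚ)).pow _).sub isIntegral_one
  set P := minpoly ℚ (shiftedPeriod ζ k (1 : ZMod p)) with hP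
  have hsep : (P.map (algebraMap ℚ ℂ)).Separable := (minpoly.irreducible hint).separable.map
  rw [(IsAlgClosed.splits (P.map (algebraMap ℚ ℂ))).eq_prod_roots_of_monic
    ((minpoly.monic hint).map _)]
  have hinj : Function.Injective fun c : Fin n => shiftedPeriod ζ k ((g ^ k) ^ (c : ℕ)) := by
    intro c d h
    simp only [← pow_mul, mul_comm k] at h
    simp only [pow_mul _ _ k] at h
    have := shiftedPeriod_pow_injective hζ hk (pow_ne_zero _ hg) (pow_ne_zero _ hg) h
    simp only [← pow_mul, mul_comm _ k] at this
    simp only [pow_mul] at this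
    exact Fin.ext (hγ.pow_inj c.2 d.2 this)
  have hroots : (P.map (algebraMap ℚ ℂ)).roots = (Finset.univ.image
      fun c : Fin n => shiftedPeriod ζ k ((g ^ k) ^ (c : ℕ))).val := by
    refine (Multiset.Nodup.ext (Polynomial.nodup_roots hsep) (Finset.nodup _)).2 fun r => ?_
    have h1 : r ∈ (P.map (algebraMap ℚ ℂ)).roots ↔ r ∈ P.rootSet ℂ := by
      rw [Polynomial.rootSet, Finset.mem_coe, Multiset.mem_toFinset, Polynomial.aroots_def]
    rw [h1, hP, rootSet_minpoly_shiftedPeriod hζ, Finset.mem_val]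
    simp only [Set.mem_ofPred_eq, Finset.mem_image, Finset.mem_univ, true_and]
    constructor
    · rintro ⟨u, hu, rfl⟩
      obtain ⟨c, hc, hcu⟩ := hγ.eq_pow_of_pow_eq_one (ξ := u ^ k)
        (by rw [← pow_mul, ← hnk, ZMod.pow_card_sub_one_eq_one hu])
      exact ⟨⟨c, hc⟩, by rw [hcu]⟩
    · rintro ⟨c, rfl⟩
      exact ⟨g ^ (c : ℕ), pow_ne_zero _ hg, by rw [← pow_mul, mul_comm, pow_mul]⟩
  rw [hroots, ← Finset.prod_image (f := fun r => Polynomial.X - Polynomial.C r) hinj.injOn]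
  rfl

end ShiftedPeriod

theorem Polynomial.coeff_one_prod_X_sub_C {R ι : Type*} [CommRing R] [Fintype ι] [DecidableEq ι]
    (r : ι → R) :
    (∏ c, (X - C (r c))).coeff 1 =
      (-1) ^ (Fintype.card ι - 1) * ∑ c, ∏ d ∈ Finset.univ.erase c, r d := by
  have h := Polynomial.coeff_derivative (∏ c, (X - C (r c))) 0
  rw [Polynomial.derivative_prod_finset] at h
  simp only [zero_add, Nat.cast_zero, mul_one] at h
  rw [← h, Polynomial.finsetSum_coeff, Finset.mul_sum]
  refine Finset.sum_congr rfl fun c _ => ?_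
  simp [Polynomial.coeff_zero_eq_eval_zero, Polynomial.eval_prod, Finset.prod_neg,
    Finset.card_erase_of_mem]

/-- The adjugate of `V * diagonal d * W`, up to scalars, when `V * W` is scalar. -/
theorem Matrix.smul_adjugate_mul_diagonal_mul {R ι : Type*} [CommRing R] [Fintype ι]
    [DecidableEq ι] {V W : Matrix ι ι R} {a : R} (h : V * W = a • (1 : Matrix ι ι R)) (d : ι → R) :
    a ^ 2 • (V * diagonal d * W).adjugate =
      a ^ Fintype.card ι • (V * (diagonal d).adjugate * W) := by
  have h' : a ^ Fintype.card ι = V.det * W.det := by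
    rw [← Matrix.det_mul, h, Matrix.det_smul, Matrix.det_one, mul_one]
  have hV : a • V.adjugate = V.det • W := by
    calc a • V.adjugate = V.adjugate * (V * W) := by rw [h]; simp
      _ = _ := by rw [← Matrix.mul_assoc, Matrix.adjugate_mul]; simp
  have hW : a • W.adjugate = W.det • V := by
    calc a • W.adjugate = (V * W) * W.adjugate := by rw [h]; simp
      _ = _ := by rw [Matrix.mul_assoc, Matrix.mul_adjugate]; simp
  rw [Matrix.adjugate_mul_distrib, Matrix.adjugate_mul_distrib]
  calc _ = (a • W.adjugate) * (diagonal d).adjugate * (a • V.adjugate) := by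
        simp only [Matrix.smul_mul, Matrix.mul_smul, smul_smul, sq, Matrix.mul_assoc]
    _ = _ := by
        rw [hV, hW, h']
        simp only [Matrix.smul_mul, Matrix.mul_smul, smul_smul]

/-- Determinant of the submatrix, without first row and column, of the circulant-type matrix
with eigenvalues `d c`. -/
theorem det_submatrix_succ_dft {K : Type*} [Field K] [CharZero K] {N : ℕ} {μ : K}
    (hμ : IsPrimitiveRoot μ (N + 2)) (d : Fin (N + 2) → K) :
    (Matrix.of fun i j : Fin (N + 1) => ∑ c : Fin (N + 2),
      μ ^ ((i + 1 : ℕ) * (c : ℕ)) * (μ ^ ((j + 1 : ℕ) * (c : ℕ)))⁻¹ * d c).det =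
      (N + 2 : K) ^ N * ∑ c, ∏ b ∈ Finset.univ.erase c, d b := by
  let V : Matrix (Fin (N + 2)) (Fin (N + 2)) K := Matrix.of fun i c => μ ^ ((i : ℕ) * (c : ℕ))
  let W : Matrix (Fin (N + 2)) (Fin (N + 2)) K := Matrix.of fun c j => (μ ^ ((j : ℕ) * (c : ℕ)))⁻¹
  have hμ0 : μ ≠ 0 := hμ.ne_zero (by omega)
  have hVW : V * W = (N + 2 : K) • (1 : Matrix (Fin (N + 2)) (Fin (N + 2)) K) := by
    ext i j
    simp only [Matrix.mul_apply, V, W, Matrix.of_apply, Matrix.smul_apply, Matrix.one_apply,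
      smul_eq_mul, mul_ite, mul_one, mul_zero]
    have hpow : ∀ c : Fin (N + 2), μ ^ ((i : ℕ) * (c : ℕ)) * (μ ^ ((j : ℕ) * (c : ℕ)))⁻¹ =
        (μ ^ (i : ℕ) * (μ ^ (j : ℕ))⁻¹) ^ (c : ℕ) := by
      intro c
      rw [mul_pow, inv_pow, pow_mul, pow_mul]
    simp only [hpow]
    split_ifs with hij
    · subst hij
      simp [mul_inv_cancel₀ (pow_ne_zero _ hμ0)]
    · rw [← Finset.sum_range (fun c => (μ ^ (i : ℕ) * (μ ^ (j : ℕ))⁻¹) ^ c)]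
      have hne : μ ^ (i : ℕ) * (μ ^ (j : ℕ))⁻¹ ≠ 1 := by
        intro h
        rw [mul_inv_eq_one₀ (pow_ne_zero _ hμ0)] at h
        exact hij (Fin.ext (hμ.pow_inj i.2 j.2 h))
      rw [geom_sum_eq hne, mul_pow, inv_pow, pow_right_comm, pow_right_comm μ (j : ℕ), hμ.pow_eq_one]
      simp
  have key := congr_fun (congr_fun (Matrix.smul_adjugate_mul_diagonal_mul hVW d) 0) 0
  rw [Matrix.smul_apply, Matrix.smul_apply, Matrix.adjugate_fin_succ_eq_det_submatrix,
    Matrix.adjugate_diagonal] at key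
  have hsub : (V * Matrix.diagonal d * W).submatrix (Fin.succAbove 0) (Fin.succAbove 0) =
      Matrix.of fun i j : Fin (N + 1) => ∑ c : Fin (N + 2),
        μ ^ ((i + 1 : ℕ) * (c : ℕ)) * (μ ^ ((j + 1 : ℕ) * (c : ℕ)))⁻¹ * d c := by
    ext i j
    rw [Matrix.submatrix_apply, Matrix.mul_apply, Matrix.of_apply]
    refine Finset.sum_congr rfl fun c _ => ?_
    rw [Matrix.mul_diagonal]
    simp only [V, W, Matrix.of_apply, Fin.succAbove_zero, Fin.val_succ]
    ring
  have hsum : (V * Matrix.diagonal (fun c => ∏ b ∈ Finset.univ.erase c, d b) * W) 0 0 =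
      ∑ c, ∏ b ∈ Finset.univ.erase c, d b := by
    rw [Matrix.mul_apply]
    refine Finset.sum_congr rfl fun c _ => ?_
    rw [Matrix.mul_diagonal]
    simp [V, W]
  rw [hsub, hsum] at key
  simp only [Fin.val_zero, add_zero, pow_zero, one_mul, Fintype.card_fin, smul_eq_mul] at key
  have h2 : (N + 2 : K) ≠ 0 := by exact_mod_cast (by omega : N + 2 ≠ 0)
  refine mul_left_cancel₀ (pow_ne_zero 2 h2) ?_
  rw [key]
  ring

/-- A generator of the group of complex characters takes a primitive root modulo `p` to a
primitive `(p - 1)`-th root of unity. -/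
theorem MulChar.isPrimitiveRoot_apply {p : ℕ} [Fact p.Prime] {χ : MulChar (ZMod p) ℂ}
    (hχ : ∀ ψ : MulChar (ZMod p) ℂ, ∃ m : ℕ, ψ = χ ^ m) {g : (ZMod p)ˣ}
    (hg : ∀ x : (ZMod p)ˣ, x ∈ Submonoid.powers g) :
    IsPrimitiveRoot (χ (g : ZMod p)) (p - 1) := by
  have hp : p.Prime := Fact.out
  have hcard : Nat.card (ZMod p)ˣ = p - 1 := by
    rw [Nat.card_eq_fintype_card, ZMod.card_units]
  have hord : orderOf χ = p - 1 := by
    rw [orderOf_eq_card_of_forall_mem_powers, ← hcard]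
    · have : NeZero (Monoid.exponent (ZMod p)ˣ) := ⟨Monoid.exponent_ne_zero_of_finite⟩
      exact MulChar.card_eq_card_units_of_hasEnoughRootsOfUnity _ _
    · intro ψ
      obtain ⟨m, hm⟩ := hχ ψ
      exact ⟨m, hm.symm⟩
  refine ⟨?_, fun l hl => ?_⟩
  · rw [← map_pow, ← Units.val_pow_eq_pow_val, ← hcard, pow_card_eq_one']
    simp
  · rw [← hord]
    refine orderOf_dvd_of_pow_eq_one (MulChar.ext fun x => ?_)
    obtain ⟨m, rfl⟩ := hg x
    rw [MulChar.pow_apply_coe, MulChar.one_apply_coe, Units.val_pow_eq_pow_val, map_pow, ← pow_mul,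
      mul_comm, pow_mul, hl, one_pow]

/-- `det D_p(k) = (-1)^{n-1} · n^{n-2} · a_p(k)`, where `D_p(k)` is the
`(n-1) × (n-1)` matrix with diagonal entries `-p` and off-diagonal entries
`G_p(χ^{ki-kj})`, and `a_p(k)` is the coefficient of `t` in the minimal polynomial over
`ℚ` of `θ_k = ∑_{y ∈ U_k} (ζ_p^y - 1)`; here `n = (p-1)/k`, `ζ_p = e^{2πi/p}` and
`G_p(ψ) = ∑_{x ∈ 𝔽_p} ψ(x) ζ_p^x`. -/
theorem det_Dpk_eq (p : ℕ) [Fact p.Prime] (hp : Odd p)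
    (k : ℕ) (hk1 : 1 ≤ k) (hk2 : k < p - 1) (hkd : k ∣ p - 1)
    (χ : MulChar (ZMod p) ℂ)
    (hχ : ∀ ψ : MulChar (ZMod p) ℂ, ∃ m : ℕ, ψ = χ ^ m)
    (n : ℕ) (hn : n = (p - 1) / k)
    (ζ : ℂ) (hζ : ζ = Complex.exp (2 * Real.pi * Complex.I / p))
    (G : MulChar (ZMod p) ℂ → ℂ) (hG : ∀ ψ, G ψ = ∑ x : ZMod p, ψ x * ζ ^ x.val)
    (θ : ℂ)
    (hθ : θ = ∑ y ∈ Finset.univ.filter (fun y : ZMod p => y ^ k = 1), (ζ ^ y.val - 1))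
    (a : ℚ) (ha : a = (minpoly ℚ θ).coeff 1) :
    Matrix.det (Matrix.of fun i j : Fin (n - 1) =>
        if i = j then (-(p : ℂ))
        else G (χ ^ (k * (i.1 + 1)) * (χ ^ (k * (j.1 + 1)))⁻¹)) =
      (-1 : ℂ) ^ (n - 1) * (n : ℂ) ^ (n - 2) * (a : ℂ) := by
  have hp' : p.Prime := Fact.out
  have hnk : p - 1 = k * n := by rw [hn, Nat.mul_div_cancel' hkd]
  obtain ⟨N, rfl⟩ : ∃ N, n = N + 2 := by
    refine ⟨n - 2, ?_⟩
    rcases n with _ | _ | n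
    · omega
    · omega
    · omega
  have hprim : IsPrimitiveRoot ζ p := hζ ▸ Complex.isPrimitiveRoot_exp p hp'.ne_zero
  obtain ⟨g, hg⟩ := IsCyclic.exists_monoid_generator (α := (ZMod p)ˣ)
  have hgprim : IsPrimitiveRoot (g : ZMod p) (p - 1) := by
    rw [IsPrimitiveRoot.coe_units_iff, ← ZMod.card_units p, ← Nat.card_eq_fintype_card,
      ← orderOf_eq_card_of_forall_mem_powers hg]
    exact IsPrimitiveRoot.orderOf g
  have hγ : IsPrimitiveRoot ((g : ZMod p) ^ k) (N + 2) := hgprim.pow (by omega) hnk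
  have hμ : IsPrimitiveRoot (χ (g : ZMod p) ^ k) (N + 2) :=
    (MulChar.isPrimitiveRoot_apply hχ hg).pow (by omega) hnk
  have hcoeff : (a : ℂ) = (-1) ^ (N + 1) * ∑ c : Fin (N + 2), ∏ b ∈ Finset.univ.erase c,
      shiftedPeriod ζ k (((g : ZMod p) ^ k) ^ (b : ℕ)) := by
    have h := congrArg (fun P => Polynomial.coeff P 1)
      (minpoly_shiftedPeriod_map hprim hnk (by omega) (by omega) g.ne_zero hγ)
    simp only [Polynomial.coeff_map, Polynomial.coeff_one_prod_X_sub_C, Fintype.card_fin] at h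
    rw [ha, hθ]
    exact h
  have hentry : ∀ ψ : MulChar (ZMod p) ℂ, ψ ≠ 1 → G ψ = ∑ x, ψ x * (ζ ^ x.val - 1) := by
    intro ψ hψ
    simp only [mul_sub, Finset.sum_sub_distrib, mul_one, MulChar.sum_eq_zero_of_ne_one hψ, hG,
      sub_zero]
  have hval0 : ∀ ψ : MulChar (ZMod p) ℂ, ψ 0 * (ζ ^ (0 : ZMod p).val - 1) = 0 := by simp
  have hsplit : ∀ i j : ℕ, ∑ x, (χ ^ (k * i) * (χ ^ (k * j))⁻¹) x * (ζ ^ x.val - 1) =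
      ∑ c : Fin (N + 2), (χ (g : ZMod p) ^ k) ^ (i * (c : ℕ)) *
        ((χ (g : ZMod p) ^ k) ^ (j * (c : ℕ)))⁻¹ *
        shiftedPeriod ζ k (((g : ZMod p) ^ k) ^ (c : ℕ)) := by
    intro i j
    rw [sum_eq_sum_pow_fiber hnk (by omega) hγ (hval0 _)]
    refine Finset.sum_congr rfl fun c _ => ?_
    rw [shiftedPeriod, Finset.mul_sum]
    refine Finset.sum_congr rfl fun x hx => ?_
    have hx' : x ^ k = ((g : ZMod p) ^ k) ^ (c : ℕ) := (Finset.mem_filter.1 hx).2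
    have hx0 : IsUnit x := by
      rw [isUnit_iff_ne_zero]
      rintro rfl
      rw [zero_pow (by omega)] at hx'
      exact pow_ne_zero _ (pow_ne_zero _ g.ne_zero) hx'.symm
    obtain ⟨x, rfl⟩ := hx0
    have hpow : ∀ m, (χ ^ (k * m)) (x : ZMod p) = (χ (g : ZMod p) ^ k) ^ (m * (c : ℕ)) := by
      intro m
      rw [MulChar.pow_apply_coe, pow_mul, ← map_pow, hx', map_pow, map_pow, ← pow_mul, ← pow_mul,
        ← pow_mul, mul_comm m]
    rw [MulChar.mul_apply, MulChar.inv_apply_eq_inv', hpow, hpow]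
  have hdiag : ∑ x, (1 : MulChar (ZMod p) ℂ) x * (ζ ^ x.val - 1) = -p := by
    have h1 : ∑ x : ZMod p, ζ ^ x.val = 0 := by
      rw [← hprim.geom_sum_eq_zero hp'.one_lt]
      refine Finset.sum_bij' (fun x _ => x.val) (fun i _ => (i : ZMod p)) ?_ ?_ ?_ ?_ ?_
      · intro x _
        simpa using ZMod.val_lt x
      · simp
      · simp
      · intro i hi
        exact ZMod.val_cast_of_lt (Finset.mem_range.1 hi)
      · simp
    calc _ = ∑ x : ZMod p, (ζ ^ x.val - 1) := by
          refine Finset.sum_congr rfl fun x _ => ?_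
          rcases eq_or_ne x 0 with rfl | hx
          · simp
          · rw [MulChar.one_apply hx.isUnit, one_mul]
      _ = _ := by simp [Finset.sum_sub_distrib, h1, ZMod.card]
  have hmat : (Matrix.of fun i j : Fin (N + 2 - 1) => if i = j then (-(p : ℂ))
        else G (χ ^ (k * (i.1 + 1)) * (χ ^ (k * (j.1 + 1)))⁻¹)) =
      Matrix.of fun i j : Fin (N + 1) => ∑ c : Fin (N + 2),
        (χ (g : ZMod p) ^ k) ^ ((i + 1 : ℕ) * (c : ℕ)) *
        ((χ (g : ZMod p) ^ k) ^ ((j + 1 : ℕ) * (c : ℕ)))⁻¹ *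
        shiftedPeriod ζ k (((g : ZMod p) ^ k) ^ (c : ℕ)) := by
    ext i j
    rw [Matrix.of_apply, Matrix.of_apply, ← hsplit]
    split_ifs with hij
    · rw [hij, mul_inv_cancel, hdiag]
    · refine hentry _ fun h => hij (Fin.ext ?_)
      rw [mul_inv_eq_one] at h
      have h' := congrArg (fun ψ : MulChar (ZMod p) ℂ => ψ (g : ZMod p)) h
      simp only [MulChar.pow_apply_coe, pow_mul] at h'
      have hi := i.2
      have hj := j.2
      have := hμ.pow_inj (by omega) (by omega) h'
      omega
  rw [hmat, hcoeff]
  refine (det_submatrix_succ_dft hμ _).trans ?_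
  have hsq : ((-1 : ℂ) ^ (N + 1)) * (-1) ^ (N + 1) = 1 := by
    rw [← mul_pow]; simp
  simp only [Nat.add_sub_cancel, Nat.add_succ_sub_one]
  push_cast
  linear_combination (-((N + 2 : ℂ) ^ N * ∑ c : Fin (N + 2), ∏ b ∈ Finset.univ.erase c,
      shiftedPeriod ζ k (((g : ZMod p) ^ k) ^ (b : ℕ)))) * hsq
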